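/- arXiv:2304.08933 — 2 statements merged into one kernel-verified Lean document; each statement's English description precedes it below -/
import Mathlib

section
/- Let E be a finite-dimensional real normed vector space, let A ⊆ E \ {0} be an open conic subset, let r ∈ ℝ, and let f : E → ℝ be differentiable at every point of A. If (fderiv f y) y = r·f(y) for every y ∈ A, then f is positively r-homogeneous on A, i.e. f(μ·y) = μ^r · f(y) for all y ∈ A and all μ > 0. -/
/-- **Euler's theorem, converse direction (fiberwise form).**
If `f` is differentiable on an open conic set `A ⊆ E \ {0}` and satisfies
`(fderiv f y) y = r * f y` on `A`, then `f` is positively `r`-homogeneous on `A`. -/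
theorem euler_converse {E : Type*} [NormedAddCommGroup E] [NormedSpace ℝ E]
    [FiniteDimensional ℝ E] (A : Set E) (hA : A ⊆ {(0 : E)}ᶜ) (hAopen : IsOpen A)
    (hAconic : ∀ y ∈ A, ∀ μ : ℝ, 0 < μ → μ • y ∈ A)
    (r : ℝ) (f : E → ℝ) (hf : ∀ y ∈ A, DifferentiableAt ℝ f y)
    (heuler : ∀ y ∈ A, fderiv ℝ f y y = r * f y) :
    ∀ y ∈ A, ∀ μ : ℝ, 0 < μ → f (μ • y) = μ ^ r * f y := by
  intro y hy μ hμ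
  have key : ∀ t : ℝ, HasDerivAt
      (fun t : ℝ => Real.exp (-(r * t)) * f (Real.exp t • y)) 0 t := by
    intro t
    have hmem := hAconic y hy (Real.exp t) (Real.exp_pos t)
    have h1 : HasDerivAt (fun t : ℝ => Real.exp t • y) (Real.exp t • y) t :=
      (Real.hasDerivAt_exp t).smul_const y
    have h2 : HasDerivAt (fun t : ℝ => f (Real.exp t • y))
        (fderiv ℝ f (Real.exp t • y) (Real.exp t • y)) t :=
      (hf _ hmem).hasFDerivAt.comp_hasDerivAt t h1
    rw [heuler _ hmem] at h2
    have h3 : HasDerivAt (fun t : ℝ => Real.exp (-(r * t)))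
        (Real.exp (-(r * t)) * (-(r * 1))) t :=
      (((hasDerivAt_id t).const_mul r).neg).exp
    refine (h3.mul h2).congr_deriv ?_
    ring
  have hc := is_const_of_deriv_eq_zero (fun t => (key t).differentiableAt)
    (fun t => (key t).deriv) (Real.log μ) 0
  simp only [Real.exp_log hμ, mul_zero, neg_zero, Real.exp_zero, one_smul, one_mul] at hc
  rw [← hc, Real.rpow_def_of_pos hμ, ← mul_assoc, ← Real.exp_add, mul_comm (Real.log μ) r,
    add_neg_cancel, Real.exp_zero, one_mul]
end

section
/- Let E be a finite-dimensional real normed vector space, let A ⊆ E \ {0} be an open conic subset, let f : E → ℝ be twice continuously differentiable on A and positively 2-homogeneous on A, and let h be a continuous symmetric bilinear form on E. If the second derivative of f is constant on A with D²f(y) = 2·h for every y ∈ A, then f(y) = h(y, y) for every y ∈ A, i.e. f is the restriction to A of a quadratic form. -/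
/-- **Constant vertical Hessian implies quadratic.**
If a positively `2`-homogeneous `C²` function `f` on an open conic set `A ⊆ E \ {0}`
has constant second derivative `D²f y = 2 h` for a continuous symmetric bilinear
form `h`, then `f y = h y y` on `A`. -/
theorem constant_hessian_implies_quadratic {E : Type*} [NormedAddCommGroup E]
    [NormedSpace ℝ E] [FiniteDimensional ℝ E]
    (A : Set E) (hA : A ⊆ {(0 : E)}ᶜ) (hAopen : IsOpen A)
    (hAconic : ∀ y ∈ A, ∀ μ : ℝ, 0 < μ → μ • y ∈ A)
    (f : E → ℝ) (hf : ContDiffOn ℝ 2 f A)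
    (hhom : ∀ y ∈ A, ∀ μ : ℝ, 0 < μ → f (μ • y) = μ ^ 2 * f y)
    (h : E →L[ℝ] E →L[ℝ] ℝ) (hsymm : ∀ v w : E, h v w = h w v)
    (hhess : ∀ y ∈ A, fderiv ℝ (fderiv ℝ f) y = (2 : ℝ) • h) :
    ∀ y ∈ A, f y = h y y := by
  intro y hy
  have hline : ∀ t : ℝ, HasDerivAt (fun s : ℝ => s • y) y t := fun t => by
    simpa using (hasDerivAt_id t).smul_const y
  have h1 : ∀ t : ℝ, 0 < t → fderiv ℝ f (t • y) y = 2 * t * f y := by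
    intro t ht
    have hmem := hAconic y hy t ht
    have hd : DifferentiableAt ℝ f (t • y) :=
      (hf.contDiffAt (hAopen.mem_nhds hmem)).differentiableAt (by norm_num)
    have e1 : HasDerivAt (fun s : ℝ => f (s • y)) (fderiv ℝ f (t • y) y) t :=
      hd.hasFDerivAt.comp_hasDerivAt t (hline t)
    have e2 : HasDerivAt (fun s : ℝ => s ^ 2 * f y) (2 * t * f y) t := by
      simpa using (hasDerivAt_pow 2 t).mul_const (f y)
    refine e1.unique (e2.congr_of_eventuallyEq ?_)
    filter_upwards [lt_mem_nhds ht] with s hs using hhom y hy s hs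
  have hd2 : DifferentiableAt ℝ (fderiv ℝ f) ((1 : ℝ) • y) := by
    rw [one_smul]
    exact ((hf.contDiffAt (hAopen.mem_nhds hy)).fderiv_right
      (m := 1) (by norm_num)).differentiableAt (by norm_num)
  have e1 : HasDerivAt (fun s : ℝ => fderiv ℝ f (s • y) y)
      (fderiv ℝ (fderiv ℝ f) ((1 : ℝ) • y) y y) 1 := by
    have k1 : HasDerivAt (fun s : ℝ => fderiv ℝ f (s • y))
        (fderiv ℝ (fderiv ℝ f) ((1 : ℝ) • y) y) 1 :=
      HasFDerivAt.comp_hasDerivAt (1 : ℝ) hd2.hasFDerivAt (hline 1)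
    exact (ContinuousLinearMap.apply ℝ ℝ y).hasFDerivAt.comp_hasDerivAt (1 : ℝ) k1
  have e2 : HasDerivAt (fun s : ℝ => 2 * s * f y) (2 * f y) 1 := by
    simpa using ((hasDerivAt_id (1 : ℝ)).const_mul 2).mul_const (f y)
  have e3 := e1.unique (e2.congr_of_eventuallyEq (by
    filter_upwards [lt_mem_nhds (zero_lt_one (α := ℝ))] with s hs using h1 s hs))
  rw [one_smul, hhess y hy] at e3
  simp at e3
  exact e3.symm
end
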